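/- arXiv:2210.07810 — 2 statements merged into one kernel-verified Lean document; each statement's English description precedes it below -/
import Mathlib

section
/- For any real numbers x₁,…,xₙ with n ≥ 4, the square of the second-order U-statistic decomposes exactly as X̄₂² = (2/(n(n−1)))·U_α + (4(n−2)/(n(n−1)))·U_β + ((n−2)(n−3)/(n(n−1)))·X̄₄, where X̄₂ = (1/(n(n−1))) Σ_{i≠j} xᵢxⱼ, U_α = (1/(n(n−1))) Σ_{i≠j} xᵢ²xⱼ², U_β = (1/(n(n−1)(n−2))) Σ_{i,j,k pairwise distinct} xᵢ²xⱼxₖ, and X̄₄ = (1/(n(n−1)(n−2)(n−3))) Σ_{i,j,k,l pairwise distinct} xᵢxⱼxₖx_l. -/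
open Finset

lemma sum_ne_one {n : ℕ} (f : Fin n → ℝ) (i : Fin n) :
    ∑ j ∈ univ.filter (fun j => j ≠ i), f j = (∑ j, f j) - f i := by
  have h : univ.filter (fun j => j ≠ i) = univ.erase i := by ext; simp
  rw [h, ← Finset.add_sum_erase univ f (mem_univ i)]; ring

lemma sum_ne_two {n : ℕ} (f : Fin n → ℝ) (i j : Fin n) (hj : j ≠ i) :
    ∑ k ∈ univ.filter (fun k => k ≠ i ∧ k ≠ j), f k = (∑ k, f k) - f i - f j := by
  have h : univ.filter (fun k => k ≠ i ∧ k ≠ j) = (univ.filter (fun k => k ≠ i)).erase j := by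
    ext; simp [and_comm]
  rw [← sum_ne_one, h,
    ← Finset.add_sum_erase (univ.filter (fun k => k ≠ i)) f (a := j) (by simp [hj])]
  ring

lemma sum_ne_three {n : ℕ} (f : Fin n → ℝ) (i j k : Fin n) (hj : j ≠ i) (hk : k ≠ i ∧ k ≠ j) :
    ∑ l ∈ univ.filter (fun l => l ≠ i ∧ l ≠ j ∧ l ≠ k), f l
      = (∑ l, f l) - f i - f j - f k := by
  have h : univ.filter (fun l => l ≠ i ∧ l ≠ j ∧ l ≠ k)
      = (univ.filter (fun l => l ≠ i ∧ l ≠ j)).erase k := by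
    ext; simp; tauto
  rw [← sum_ne_two f i j hj, h,
    ← Finset.add_sum_erase (univ.filter (fun l => l ≠ i ∧ l ≠ j)) f (a := k) (by simp [hk])]
  ring

lemma sum_poly {n : ℕ} (x f : Fin n → ℝ) (a b c d : ℝ)
    (h : ∀ i, f i = a * x i + b * x i ^ 2 + c * x i ^ 3 + d * x i ^ 4) :
    ∑ i, f i = a * ∑ i, x i + b * ∑ i, x i ^ 2 + c * ∑ i, x i ^ 3 + d * ∑ i, x i ^ 4 := by
  simp only [h, sum_add_distrib, mul_sum]


/-- **Decomposition of the square of the second-order U-statistic.**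
For any real numbers `x₁,…,xₙ` with `n ≥ 4`,
`X̄₂² = (2/(n(n−1)))·U_α + (4(n−2)/(n(n−1)))·U_β + ((n−2)(n−3)/(n(n−1)))·X̄₄`,
where all sums run over ordered tuples of pairwise distinct indices and
`X̄₂ = (1/(n(n−1))) Σ_{i≠j} xᵢxⱼ`, `U_α = (1/(n(n−1))) Σ_{i≠j} xᵢ²xⱼ²`,
`U_β = (1/(n(n−1)(n−2))) Σ xᵢ²xⱼxₖ`,
`X̄₄ = (1/(n(n−1)(n−2)(n−3))) Σ xᵢxⱼxₖx_l`. -/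
theorem ustat2_sq_decomposition
    (n : ℕ) (hn : 4 ≤ n) (x : Fin n → ℝ)
    (X2 Ua Ub X4 : ℝ)
    (hX2 : X2 = (1 / ((n : ℝ) * ((n : ℝ) - 1))) *
      ∑ i : Fin n, ∑ j ∈ univ.filter (fun j => j ≠ i), x i * x j)
    (hUa : Ua = (1 / ((n : ℝ) * ((n : ℝ) - 1))) *
      ∑ i : Fin n, ∑ j ∈ univ.filter (fun j => j ≠ i), x i ^ 2 * x j ^ 2)
    (hUb : Ub = (1 / ((n : ℝ) * ((n : ℝ) - 1) * ((n : ℝ) - 2))) *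
      ∑ i : Fin n, ∑ j ∈ univ.filter (fun j => j ≠ i),
        ∑ k ∈ univ.filter (fun k => k ≠ i ∧ k ≠ j), x i ^ 2 * x j * x k)
    (hX4 : X4 = (1 / ((n : ℝ) * ((n : ℝ) - 1) * ((n : ℝ) - 2) * ((n : ℝ) - 3))) *
      ∑ i : Fin n, ∑ j ∈ univ.filter (fun j => j ≠ i),
        ∑ k ∈ univ.filter (fun k => k ≠ i ∧ k ≠ j),
          ∑ l ∈ univ.filter (fun l => l ≠ i ∧ l ≠ j ∧ l ≠ k),
            x i * x j * x k * x l) :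
    X2 ^ 2 = (2 / ((n : ℝ) * ((n : ℝ) - 1))) * Ua
      + (4 * ((n : ℝ) - 2) / ((n : ℝ) * ((n : ℝ) - 1))) * Ub
      + (((n : ℝ) - 2) * ((n : ℝ) - 3) / ((n : ℝ) * ((n : ℝ) - 1))) * X4 := by
  obtain ⟨p1, h1⟩ : ∃ p, p = ∑ i, x i := ⟨_, rfl⟩
  obtain ⟨p2, h2⟩ : ∃ p, p = ∑ i, x i ^ 2 := ⟨_, rfl⟩
  obtain ⟨p3, h3⟩ : ∃ p, p = ∑ i, x i ^ 3 := ⟨_, rfl⟩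
  obtain ⟨p4, h4⟩ : ∃ p, p = ∑ i, x i ^ 4 := ⟨_, rfl⟩
  have sp : ∀ (f : Fin n → ℝ) (a b c d : ℝ),
      (∀ i, f i = a * x i + b * x i ^ 2 + c * x i ^ 3 + d * x i ^ 4) →
      ∑ i, f i = a * p1 + b * p2 + c * p3 + d * p4 := by
    intro f a b c d h
    rw [sum_poly x f a b c d h, h1, h2, h3, h4]
  have e2 : ∑ i : Fin n, ∑ j ∈ univ.filter (fun j => j ≠ i), x i * x j = p1 ^ 2 - p2 := by
    rw [sp _ p1 (-1) 0 0]
    · ring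
    intro i
    rw [sum_ne_one, sp _ (x i) 0 0 0 (fun j => by ring)]
    ring
  have ea : ∑ i : Fin n, ∑ j ∈ univ.filter (fun j => j ≠ i), x i ^ 2 * x j ^ 2
      = p2 ^ 2 - p4 := by
    rw [sp _ 0 p2 0 (-1)]
    · ring
    intro i
    rw [sum_ne_one, sp _ 0 (x i ^ 2) 0 0 (fun j => by ring)]
    ring
  have eb : ∑ i : Fin n, ∑ j ∈ univ.filter (fun j => j ≠ i),
        ∑ k ∈ univ.filter (fun k => k ≠ i ∧ k ≠ j), x i ^ 2 * x j * x k
      = p2 * p1 ^ 2 - p2 ^ 2 - 2 * p3 * p1 + 2 * p4 := by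
    rw [sp _ 0 (p1 ^ 2 - p2) (-2 * p1) 2]
    · ring
    intro i
    have : ∀ j ∈ univ.filter (fun j => j ≠ i),
        ∑ k ∈ univ.filter (fun k => k ≠ i ∧ k ≠ j), x i ^ 2 * x j * x k
          = x i ^ 2 * x j * (p1 - x i - x j) := by
      intro j hj
      rw [sum_ne_two _ i j (by simpa using hj), sp _ (x i ^ 2 * x j) 0 0 0 (fun j => by ring)]
      ring
    rw [sum_congr rfl this, sum_ne_one,
      sp _ (x i ^ 2 * (p1 - x i)) (-x i ^ 2) 0 0 (fun j => by ring)]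
    ring
  have e4 : ∑ i : Fin n, ∑ j ∈ univ.filter (fun j => j ≠ i),
        ∑ k ∈ univ.filter (fun k => k ≠ i ∧ k ≠ j),
          ∑ l ∈ univ.filter (fun l => l ≠ i ∧ l ≠ j ∧ l ≠ k),
            x i * x j * x k * x l
      = p1 ^ 4 - 6 * p1 ^ 2 * p2 + 3 * p2 ^ 2 + 8 * p1 * p3 - 6 * p4 := by
    rw [sp _ (p1 ^ 3 - 3 * p1 * p2 + 2 * p3) (-3 * p1 ^ 2 + 3 * p2) (6 * p1) (-6)]
    · ring
    intro i
    have : ∀ j ∈ univ.filter (fun j => j ≠ i),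
        ∑ k ∈ univ.filter (fun k => k ≠ i ∧ k ≠ j),
          ∑ l ∈ univ.filter (fun l => l ≠ i ∧ l ≠ j ∧ l ≠ k), x i * x j * x k * x l
          = x i * x j * ((p1 - x i - x j) ^ 2 - (p2 - x i ^ 2 - x j ^ 2)) := by
      intro j hj
      have hj' : j ≠ i := by simpa using hj
      have : ∀ k ∈ univ.filter (fun k => k ≠ i ∧ k ≠ j),
          ∑ l ∈ univ.filter (fun l => l ≠ i ∧ l ≠ j ∧ l ≠ k), x i * x j * x k * x l
            = x i * x j * x k * (p1 - x i - x j - x k) := by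
        intro k hk
        rw [sum_ne_three _ i j k hj' (by simpa using hk),
          sp _ (x i * x j * x k) 0 0 0 (fun j => by ring)]
        ring
      rw [sum_congr rfl this, sum_ne_two _ i j hj',
        sp _ (x i * x j * (p1 - x i - x j)) (-(x i * x j)) 0 0 (fun j => by ring)]
      ring
    rw [sum_congr rfl this, sum_ne_one,
      sp _ (x i * ((p1 - x i) ^ 2 - p2 + x i ^ 2)) (-2 * x i * (p1 - x i)) (2 * x i) 0
        (fun j => by ring)]
    ring
  rw [e2] at hX2
  rw [ea] at hUa
  rw [eb] at hUb
  rw [e4] at hX4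
  have hn' : (4 : ℝ) ≤ n := by exact_mod_cast hn
  have n0 : (n : ℝ) ≠ 0 := by linarith
  have n1 : (n : ℝ) - 1 ≠ 0 := by linarith
  have n2 : (n : ℝ) - 2 ≠ 0 := by linarith
  have n3 : (n : ℝ) - 3 ≠ 0 := by linarith
  subst hX2 hUa hUb hX4
  field_simp
  ring
end

section
/- For any real numbers x₁,…,xₙ with n ≥ 6, the cube of the second-order U-statistic decomposes exactly as X̄₂³ = (1/(n²(n−1)²))·[4·U_I + 24(n−2)·U_II + 8(n−2)·U_III + 8(n−2)(n−3)·U_IV + 30(n−2)(n−3)·U_V + 12(n−2)(n−3)(n−4)·U_VI + (n−2)(n−3)(n−4)(n−5)·X̄₆]. -/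
open Finset

lemma peel {n : ℕ} (h : Fin n → ℝ) (P : Fin n → Prop) [DecidablePred P] (a : Fin n) (ha : P a) :
    ∑ q ∈ univ.filter (fun q => q ≠ a ∧ P q), h q = ∑ q ∈ univ.filter P, h q - h a := by
  have e : univ.filter (fun q => q ≠ a ∧ P q) = (univ.filter P).erase a := by
    ext q; simp
  rw [e, ← Finset.add_sum_erase _ h (show a ∈ univ.filter P by simpa using ha)]
  ring

lemma peel1 {n : ℕ} (h : Fin n → ℝ) (a : Fin n) :
    ∑ q ∈ univ.filter (fun q => q ≠ a), h q = ∑ q, h q - h a := by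
  have := peel h (fun _ => True) a trivial
  simpa using this

def D2 {n : ℕ} (a b : Fin n → ℝ) : ℝ :=
  ∑ i : Fin n, ∑ j ∈ univ.filter (fun j => j ≠ i),
    a i * b j

lemma D2_eq {n : ℕ} (a b : Fin n → ℝ) :
    D2 a b = (∑ i, a i) * (∑ i, b i) - ∑ i, a i * b i := by
  unfold D2
  simp only [← Finset.mul_sum, peel1, Finset.sum_mul, ← Finset.sum_sub_distrib, mul_sub]

def D3 {n : ℕ} (a b c : Fin n → ℝ) : ℝ :=
  ∑ i : Fin n, ∑ j ∈ univ.filter (fun j => j ≠ i),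
    ∑ k ∈ univ.filter (fun k => k ≠ i ∧ k ≠ j),
    a i * b j * c k

lemma D3_eq {n : ℕ} (a b c : Fin n → ℝ) :
    D3 a b c = D2 a b * (∑ i, c i) - D2 (fun i => a i * c i) b - D2 a (fun i => b i * c i) := by
  unfold D3 D2
  simp only [Finset.sum_mul, ← Finset.sum_sub_distrib]
  refine Finset.sum_congr rfl fun i _ => ?_
  refine Finset.sum_congr rfl fun j hj => ?_
  simp only [Finset.mem_filter, Finset.mem_univ, true_and] at hj
  rw [← Finset.mul_sum, peel _ (fun q => q ≠ j) i (by grind), peel1]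
  ring

def D4 {n : ℕ} (a b c d : Fin n → ℝ) : ℝ :=
  ∑ i : Fin n, ∑ j ∈ univ.filter (fun j => j ≠ i),
    ∑ k ∈ univ.filter (fun k => k ≠ i ∧ k ≠ j),
    ∑ l ∈ univ.filter (fun l => l ≠ i ∧ l ≠ j ∧ l ≠ k),
    a i * b j * c k * d l

lemma D4_eq {n : ℕ} (a b c d : Fin n → ℝ) :
    D4 a b c d = D3 a b c * (∑ i, d i) - D3 (fun i => a i * d i) b c - D3 a (fun i => b i * d i) c - D3 a b (fun i => c i * d i) := by
  unfold D4 D3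
  simp only [Finset.sum_mul, ← Finset.sum_sub_distrib]
  refine Finset.sum_congr rfl fun i _ => ?_
  refine Finset.sum_congr rfl fun j hj => ?_
  simp only [Finset.mem_filter, Finset.mem_univ, true_and] at hj
  refine Finset.sum_congr rfl fun k hk => ?_
  simp only [Finset.mem_filter, Finset.mem_univ, true_and] at hk
  rw [← Finset.mul_sum, peel _ (fun q => q ≠ j ∧ q ≠ k) i (by grind), peel _ (fun q => q ≠ k) j (by grind), peel1]
  ring

def D5 {n : ℕ} (a b c d e : Fin n → ℝ) : ℝ :=
  ∑ i : Fin n, ∑ j ∈ univ.filter (fun j => j ≠ i),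
    ∑ k ∈ univ.filter (fun k => k ≠ i ∧ k ≠ j),
    ∑ l ∈ univ.filter (fun l => l ≠ i ∧ l ≠ j ∧ l ≠ k),
    ∑ p ∈ univ.filter (fun p => p ≠ i ∧ p ≠ j ∧ p ≠ k ∧ p ≠ l),
    a i * b j * c k * d l * e p

lemma D5_eq {n : ℕ} (a b c d e : Fin n → ℝ) :
    D5 a b c d e = D4 a b c d * (∑ i, e i) - D4 (fun i => a i * e i) b c d - D4 a (fun i => b i * e i) c d - D4 a b (fun i => c i * e i) d - D4 a b c (fun i => d i * e i) := by
  unfold D5 D4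
  simp only [Finset.sum_mul, ← Finset.sum_sub_distrib]
  refine Finset.sum_congr rfl fun i _ => ?_
  refine Finset.sum_congr rfl fun j hj => ?_
  simp only [Finset.mem_filter, Finset.mem_univ, true_and] at hj
  refine Finset.sum_congr rfl fun k hk => ?_
  simp only [Finset.mem_filter, Finset.mem_univ, true_and] at hk
  refine Finset.sum_congr rfl fun l hl => ?_
  simp only [Finset.mem_filter, Finset.mem_univ, true_and] at hl
  rw [← Finset.mul_sum, peel _ (fun q => q ≠ j ∧ q ≠ k ∧ q ≠ l) i (by grind), peel _ (fun q => q ≠ k ∧ q ≠ l) j (by grind), peel _ (fun q => q ≠ l) k (by grind), peel1]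
  ring

def D6 {n : ℕ} (a b c d e f : Fin n → ℝ) : ℝ :=
  ∑ i : Fin n, ∑ j ∈ univ.filter (fun j => j ≠ i),
    ∑ k ∈ univ.filter (fun k => k ≠ i ∧ k ≠ j),
    ∑ l ∈ univ.filter (fun l => l ≠ i ∧ l ≠ j ∧ l ≠ k),
    ∑ p ∈ univ.filter (fun p => p ≠ i ∧ p ≠ j ∧ p ≠ k ∧ p ≠ l),
    ∑ q ∈ univ.filter (fun q => q ≠ i ∧ q ≠ j ∧ q ≠ k ∧ q ≠ l ∧ q ≠ p),
    a i * b j * c k * d l * e p * f q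

lemma D6_eq {n : ℕ} (a b c d e f : Fin n → ℝ) :
    D6 a b c d e f = D5 a b c d e * (∑ i, f i) - D5 (fun i => a i * f i) b c d e - D5 a (fun i => b i * f i) c d e - D5 a b (fun i => c i * f i) d e - D5 a b c (fun i => d i * f i) e - D5 a b c d (fun i => e i * f i) := by
  unfold D6 D5
  simp only [Finset.sum_mul, ← Finset.sum_sub_distrib]
  refine Finset.sum_congr rfl fun i _ => ?_
  refine Finset.sum_congr rfl fun j hj => ?_
  simp only [Finset.mem_filter, Finset.mem_univ, true_and] at hj
  refine Finset.sum_congr rfl fun k hk => ?_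
  simp only [Finset.mem_filter, Finset.mem_univ, true_and] at hk
  refine Finset.sum_congr rfl fun l hl => ?_
  simp only [Finset.mem_filter, Finset.mem_univ, true_and] at hl
  refine Finset.sum_congr rfl fun p hp => ?_
  simp only [Finset.mem_filter, Finset.mem_univ, true_and] at hp
  rw [← Finset.mul_sum, peel _ (fun q => q ≠ j ∧ q ≠ k ∧ q ≠ l ∧ q ≠ p) i (by grind), peel _ (fun q => q ≠ k ∧ q ≠ l ∧ q ≠ p) j (by grind), peel _ (fun q => q ≠ l ∧ q ≠ p) k (by grind), peel _ (fun q => q ≠ p) l (by grind), peel1]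
  ring

lemma key {n : ℕ} (x : Fin n → ℝ) :
    (D2 x x) ^ 3 = 4 * D2 (fun i => x i ^ 3) (fun i => x i ^ 3)
      + 24 * D3 (fun i => x i ^ 3) (fun i => x i ^ 2) x
      + 8 * D3 (fun i => x i ^ 2) (fun i => x i ^ 2) (fun i => x i ^ 2)
      + 8 * D4 (fun i => x i ^ 3) x x x
      + 30 * D4 (fun i => x i ^ 2) (fun i => x i ^ 2) x x
      + 12 * D5 (fun i => x i ^ 2) x x x x
      + 1 * D6 x x x x x x := by
  simp only [D6_eq, D5_eq, D4_eq, D3_eq, D2_eq]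
  simp only [← pow_succ, ← pow_succ', ← pow_add, ← sq, ← pow_mul]
  norm_num only
  ring

/-- **Decomposition of the cube of the second-order U-statistic.**
For any real numbers `x₁,…,xₙ` with `n ≥ 6`,
`X̄₂³ = (1/(n²(n−1)²))·[4·U_I + 24(n−2)·U_II + 8(n−2)·U_III + 8(n−2)(n−3)·U_IV
  + 30(n−2)(n−3)·U_V + 12(n−2)(n−3)(n−4)·U_VI + (n−2)(n−3)(n−4)(n−5)·X̄₆]`,
where all sums run over ordered tuples of pairwise distinct indices. -/
theorem ustat2_cube_decomposition
    (n : ℕ) (hn : 6 ≤ n) (x : Fin n → ℝ)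
    (X2 UI UII UIII UIV UV UVI X6 : ℝ)
    (hX2 : X2 = (1 / ((n : ℝ) * ((n : ℝ) - 1))) *
      ∑ i : Fin n, ∑ j ∈ univ.filter (fun j => j ≠ i), x i * x j)
    (hUI : UI = (1 / ((n : ℝ) * ((n : ℝ) - 1))) *
      ∑ i : Fin n, ∑ j ∈ univ.filter (fun j => j ≠ i), x i ^ 3 * x j ^ 3)
    (hUII : UII = (1 / ((n : ℝ) * ((n : ℝ) - 1) * ((n : ℝ) - 2))) *
      ∑ i : Fin n, ∑ j ∈ univ.filter (fun j => j ≠ i),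
        ∑ k ∈ univ.filter (fun k => k ≠ i ∧ k ≠ j), x i ^ 3 * x j ^ 2 * x k)
    (hUIII : UIII = (1 / ((n : ℝ) * ((n : ℝ) - 1) * ((n : ℝ) - 2))) *
      ∑ i : Fin n, ∑ j ∈ univ.filter (fun j => j ≠ i),
        ∑ k ∈ univ.filter (fun k => k ≠ i ∧ k ≠ j), x i ^ 2 * x j ^ 2 * x k ^ 2)
    (hUIV : UIV = (1 / ((n : ℝ) * ((n : ℝ) - 1) * ((n : ℝ) - 2) * ((n : ℝ) - 3))) *
      ∑ i : Fin n, ∑ j ∈ univ.filter (fun j => j ≠ i),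
        ∑ k ∈ univ.filter (fun k => k ≠ i ∧ k ≠ j),
          ∑ l ∈ univ.filter (fun l => l ≠ i ∧ l ≠ j ∧ l ≠ k),
            x i ^ 3 * x j * x k * x l)
    (hUV : UV = (1 / ((n : ℝ) * ((n : ℝ) - 1) * ((n : ℝ) - 2) * ((n : ℝ) - 3))) *
      ∑ i : Fin n, ∑ j ∈ univ.filter (fun j => j ≠ i),
        ∑ k ∈ univ.filter (fun k => k ≠ i ∧ k ≠ j),
          ∑ l ∈ univ.filter (fun l => l ≠ i ∧ l ≠ j ∧ l ≠ k),
            x i ^ 2 * x j ^ 2 * x k * x l)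
    (hUVI : UVI = (1 / ((n : ℝ) * ((n : ℝ) - 1) * ((n : ℝ) - 2) * ((n : ℝ) - 3)
        * ((n : ℝ) - 4))) *
      ∑ i : Fin n, ∑ j ∈ univ.filter (fun j => j ≠ i),
        ∑ k ∈ univ.filter (fun k => k ≠ i ∧ k ≠ j),
          ∑ l ∈ univ.filter (fun l => l ≠ i ∧ l ≠ j ∧ l ≠ k),
            ∑ p ∈ univ.filter (fun p => p ≠ i ∧ p ≠ j ∧ p ≠ k ∧ p ≠ l),
              x i ^ 2 * x j * x k * x l * x p)
    (hX6 : X6 = (1 / ((n : ℝ) * ((n : ℝ) - 1) * ((n : ℝ) - 2) * ((n : ℝ) - 3)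
        * ((n : ℝ) - 4) * ((n : ℝ) - 5))) *
      ∑ i : Fin n, ∑ j ∈ univ.filter (fun j => j ≠ i),
        ∑ k ∈ univ.filter (fun k => k ≠ i ∧ k ≠ j),
          ∑ l ∈ univ.filter (fun l => l ≠ i ∧ l ≠ j ∧ l ≠ k),
            ∑ p ∈ univ.filter (fun p => p ≠ i ∧ p ≠ j ∧ p ≠ k ∧ p ≠ l),
              ∑ q ∈ univ.filter (fun q => q ≠ i ∧ q ≠ j ∧ q ≠ k ∧ q ≠ l ∧ q ≠ p),
                x i * x j * x k * x l * x p * x q) :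
    X2 ^ 3 = (1 / ((n : ℝ) ^ 2 * ((n : ℝ) - 1) ^ 2)) *
      (4 * UI + 24 * ((n : ℝ) - 2) * UII + 8 * ((n : ℝ) - 2) * UIII
        + 8 * ((n : ℝ) - 2) * ((n : ℝ) - 3) * UIV
        + 30 * ((n : ℝ) - 2) * ((n : ℝ) - 3) * UV
        + 12 * ((n : ℝ) - 2) * ((n : ℝ) - 3) * ((n : ℝ) - 4) * UVI
        + ((n : ℝ) - 2) * ((n : ℝ) - 3) * ((n : ℝ) - 4) * ((n : ℝ) - 5) * X6) := by
  have key := key x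
  change X2 = _ * (D2 x x) at hX2
  change UI = _ * (D2 (fun i => x i ^ 3) (fun i => x i ^ 3)) at hUI
  change UII = _ * (D3 (fun i => x i ^ 3) (fun i => x i ^ 2) x) at hUII
  change UIII = _ * (D3 (fun i => x i ^ 2) (fun i => x i ^ 2) (fun i => x i ^ 2)) at hUIII
  change UIV = _ * (D4 (fun i => x i ^ 3) x x x) at hUIV
  change UV = _ * (D4 (fun i => x i ^ 2) (fun i => x i ^ 2) x x) at hUV
  change UVI = _ * (D5 (fun i => x i ^ 2) x x x x) at hUVI
  change X6 = _ * (D6 x x x x x x) at hX6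
  have hn' : (6 : ℝ) ≤ n := by exact_mod_cast hn
  have h0 : (n : ℝ) ≠ 0 := by linarith
  have h1 : (n : ℝ) - 1 ≠ 0 := by linarith
  have h2 : (n : ℝ) - 2 ≠ 0 := by linarith
  have h3 : (n : ℝ) - 3 ≠ 0 := by linarith
  have h4 : (n : ℝ) - 4 ≠ 0 := by linarith
  have h5 : (n : ℝ) - 5 ≠ 0 := by linarith
  rw [hX2, hUI, hUII, hUIII, hUIV, hUV, hUVI, hX6, mul_pow, key]
  field_simp
end
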